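/- arXiv:2406.06815 — 3 statements merged into one kernel-verified Lean document; each statement's English description precedes it below -/
import Mathlib

section
/- Let M ∈ ℕ, M ≥ 1, and let g be the discrete Gaussian. Then for every x ∈ [0,1]: |G_g(x)| ≤ (4/√M)·e^{−πM(x − 1/2)²}. -/
open scoped Classical

noncomputable section

/-- `e^{-2πi x}` -/
def ec (x : ℝ) : ℂ := Complex.exp (-(2 * Real.pi * x) * Complex.I)

/-- The 1-periodic function `G_f(x) = M^{-1/2} Σ_{l ∈ ℤ} f(l) e^{-2πi l x}`. -/
def Gf (M : ℕ) (f : ℤ → ℂ) (x : ℝ) : ℂ :=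
  ((Real.sqrt M)⁻¹ : ℝ) * ∑' l : ℤ, f l * ec ((l : ℝ) * x)

/-- The alphabet `A = { l ∈ {0,…,M-1} : |l - M/2| ≤ M^δ/2 }`. -/
def alphabetA (M : ℕ) (δ : ℝ) : Finset ℕ :=
  (Finset.range M).filter fun l => |(l : ℝ) - (M : ℝ) / 2| ≤ (M : ℝ) ^ δ / 2

/-- The discrete Gaussian `g(l) = M^{-1/2} e^{-π(l-M/2)²/M} e^{iπl}`. -/
def gaussD (M : ℕ) : ℤ → ℂ := fun l =>
  (((Real.sqrt M)⁻¹ * Real.exp (-(Real.pi * ((l : ℝ) - (M : ℝ) / 2) ^ 2 / (M : ℝ))) : ℝ) : ℂ) *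
    Complex.exp ((Real.pi * (l : ℝ) : ℝ) * Complex.I)

/-- The restriction `f·𝟙_A` of `f : ℤ → ℂ` to an alphabet `A ⊆ ℕ`, extended by zero. -/
def restrictA (A : Finset ℕ) (f : ℤ → ℂ) : ℤ → ℂ := fun l =>
  if ∃ a ∈ A, l = (a : ℤ) then f l else 0

/-- A majorant on the integers with total mass four. -/
def majC (n : ℤ) : ℝ := if n = 0 then 1 else (1 / 3 : ℝ) ^ (n.natAbs - 1)

lemma hasSum_majC : HasSum majC 4 := by
  have hg : HasSum (fun n : ℕ => (1 / 3 : ℝ) ^ n) (3 / 2) := by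
    have := hasSum_geometric_of_lt_one (r := (1 / 3 : ℝ)) (by norm_num) (by norm_num)
    convert this using 1
    norm_num
  have h1 : HasSum (fun n : ℕ => majC (n : ℤ)) (5 / 2) := by
    rw [← hasSum_nat_add_iff' 1]
    have e : (fun n : ℕ => majC ((n + 1 : ℕ) : ℤ)) = fun n : ℕ => (1 / 3 : ℝ) ^ n := by
      funext n
      have h0 : ((n + 1 : ℕ) : ℤ) ≠ 0 := by omega
      have h2 : ((n + 1 : ℕ) : ℤ).natAbs - 1 = n := by omega
      rw [majC, if_neg h0, h2]
    have e2 : (5 / 2 : ℝ) - ∑ i ∈ Finset.range 1, majC (i : ℤ) = 3 / 2 := by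
      simp [majC]
      norm_num
    rw [e, e2]
    exact hg
  have h2 : HasSum (fun n : ℕ => majC (-((n : ℤ) + 1))) (3 / 2) := by
    have e : (fun n : ℕ => majC (-((n : ℤ) + 1))) = fun n : ℕ => (1 / 3 : ℝ) ^ n := by
      funext n
      have h0 : -((n : ℤ) + 1) ≠ 0 := by omega
      have h2 : (-((n : ℤ) + 1)).natAbs - 1 = n := by omega
      rw [majC, if_neg h0, h2]
    rw [e]
    exact hg
  have := HasSum.of_nat_of_neg_add_one h1 h2
  convert this using 1
  norm_num

lemma exp_le_majC (M : ℕ) (hM : 1 ≤ M) (t : ℝ) (ht : |t| ≤ 1 / 2) (n : ℤ) :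
    Real.exp (-(Real.pi * M * (((n : ℝ) + t) ^ 2 - t ^ 2))) ≤ majC n := by
  by_cases h0 : n = 0
  · simp [majC, h0]
  rw [majC, if_neg h0]
  set k : ℕ := n.natAbs - 1 with hk
  have hnk : n.natAbs = k + 1 := by omega
  have habs : |(n : ℝ)| = (k : ℝ) + 1 := by
    have : ((n.natAbs : ℕ) : ℝ) = |(n : ℝ)| := by simp
    rw [← this, hnk]; push_cast; ring
  have hkey : (k : ℝ) ≤ ((n : ℝ) + t) ^ 2 - t ^ 2 := by
    have h1 : -(|(n : ℝ)| * |t|) ≤ n * t := by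
      rw [← abs_mul]; exact neg_abs_le _
    have h2 : (n : ℝ) ^ 2 = ((k : ℝ) + 1) ^ 2 := by rw [← sq_abs, habs]
    rw [habs] at h1
    have h3 : ((k : ℝ) + 1) * |t| ≤ (k + 1) * (1 / 2) := by gcongr
    have h4 : (k : ℝ) ≤ (k : ℝ) * k := by exact_mod_cast Nat.le_mul_self k
    nlinarith
  have hM' : (1 : ℝ) ≤ M := by exact_mod_cast hM
  have hpi := Real.pi_gt_three
  have hk0 : (0 : ℝ) ≤ k := by positivity
  have h13 : Real.exp (-2) ≤ 1 / 3 := by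
    rw [Real.exp_neg, one_div]
    apply inv_anti₀ (by norm_num)
    have := Real.add_one_le_exp (2 : ℝ)
    linarith
  calc _ ≤ Real.exp ((k : ℝ) * (-2)) := by
        apply Real.exp_le_exp.mpr
        have : (2 : ℝ) * k ≤ Real.pi * M * (((n : ℝ) + t) ^ 2 - t ^ 2) := by
          apply mul_le_mul _ hkey hk0 (by positivity)
          nlinarith
        linarith
    _ = Real.exp (-2) ^ k := by rw [Real.exp_nat_mul]
    _ ≤ _ := by gcongr

/-- `|G_g(x)| ≤ (4/√M) e^{-πM(x-1/2)²}` for `x ∈ [0,1]`. -/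
theorem stmt10 (M : ℕ) (hM : 1 ≤ M) (x : ℝ) (hx : x ∈ Set.Icc (0 : ℝ) 1) :
    ‖Gf M (gaussD M) x‖ ≤
      4 / Real.sqrt M * Real.exp (-(Real.pi * (M : ℝ) * (x - 1 / 2) ^ 2)) := by
  have hM' : (0 : ℝ) < M := by exact_mod_cast hM
  have hMc : (M : ℂ) ≠ 0 := by exact_mod_cast hM'.ne'
  set t : ℝ := x - 1 / 2 with htdef
  have ht : |t| ≤ 1 / 2 := by
    rw [abs_le]; constructor <;> linarith [hx.1, hx.2]
  have hs : 0 < Real.sqrt M := Real.sqrt_pos.mpr hM'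
  have hterm : ∀ l : ℤ, gaussD M l * ec ((l : ℝ) * x) =
      (((Real.sqrt M)⁻¹ : ℝ) * Complex.exp (-(Real.pi * M / 4))) *
        Complex.exp (-Real.pi * ((M : ℂ)⁻¹) * (l : ℂ) ^ 2 +
          2 * Real.pi * (1 / 2 - Complex.I * t) * l) := by
    intro l
    rw [gaussD, ec, Complex.ofReal_mul, Complex.ofReal_exp, mul_assoc, mul_assoc,
      ← Complex.exp_add, ← Complex.exp_add, mul_assoc (((Real.sqrt M)⁻¹ : ℝ) : ℂ),
      ← Complex.exp_add]
    congr 2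
    rw [htdef]
    push_cast
    field_simp
    ring
  have ha : 0 < ((M : ℂ)⁻¹).re := by
    rw [← Complex.ofReal_natCast, ← Complex.ofReal_inv, Complex.ofReal_re]
    positivity
  have hpois := Complex.tsum_exp_neg_quadratic ha (1 / 2 - Complex.I * t)
  have hroot : ‖1 / ((M : ℂ)⁻¹) ^ (1 / 2 : ℂ)‖ = Real.sqrt M := by
    have : ((M : ℂ)⁻¹) ^ (1 / 2 : ℂ) = (((Real.sqrt M)⁻¹ : ℝ) : ℂ) := by
      rw [← Real.sqrt_inv, Real.sqrt_eq_rpow, Complex.ofReal_cpow (by positivity)]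
      push_cast
      rfl
    rw [this, norm_div, norm_one, Complex.norm_real, Real.norm_of_nonneg (by positivity),
      one_div, inv_inv]
  have hnorm : ∀ n : ℤ, ‖Complex.exp (-Real.pi / ((M : ℂ)⁻¹) *
      ((n : ℂ) + Complex.I * (1 / 2 - Complex.I * t)) ^ 2)‖ ≤
      (Real.exp (Real.pi * M / 4) * Real.exp (-(Real.pi * M * t ^ 2))) * majC n := by
    intro n
    have e : -Real.pi / ((M : ℂ)⁻¹) * ((n : ℂ) + Complex.I * (1 / 2 - Complex.I * t)) ^ 2 =
        ((-(Real.pi * M * ((n + t) ^ 2 - 1 / 4)) : ℝ) : ℂ) +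
          ((-(Real.pi * M * (n + t)) : ℝ) : ℂ) * Complex.I := by
      push_cast
      rw [div_inv_eq_mul]
      have h1 : (n : ℂ) + Complex.I * (1 / 2 - Complex.I * t) = (n + t) + Complex.I / 2 := by
        linear_combination (-(t : ℂ)) * Complex.I_sq
      rw [h1]
      linear_combination (-(Real.pi : ℂ) * M / 4) * Complex.I_sq
    rw [e, Complex.exp_add, norm_mul, Complex.norm_exp_ofReal_mul_I, mul_one,
      Complex.norm_exp, Complex.ofReal_re]
    refine le_trans (le_of_eq ?_) (mul_le_mul_of_nonneg_left (exp_le_majC M hM t ht n)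
      (by positivity))
    rw [← Real.exp_add, ← Real.exp_add]
    congr 1
    ring
  have hsum := tsum_of_norm_bounded (hasSum_majC.mul_left
    (Real.exp (Real.pi * M / 4) * Real.exp (-(Real.pi * M * t ^ 2)))) hnorm
  have hexp : ‖Complex.exp (-(Real.pi * M / 4))‖ = Real.exp (-(Real.pi * M / 4)) := by
    have : (-(Real.pi * M / 4) : ℂ) = ((-(Real.pi * M / 4) : ℝ) : ℂ) := by push_cast; rfl
    rw [this, Complex.norm_exp, Complex.ofReal_re]
  rw [Gf, tsum_congr hterm, tsum_mul_left, hpois, norm_mul, norm_mul, norm_mul, norm_mul, hroot,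
    hexp, Complex.norm_real, Real.norm_of_nonneg (by positivity : (0 : ℝ) ≤ (Real.sqrt M)⁻¹)]
  have hE : Real.exp (-(Real.pi * M / 4)) * Real.exp (Real.pi * M / 4) = 1 := by
    rw [← Real.exp_add]; simp
  calc _ ≤ (Real.sqrt M)⁻¹ * ((Real.sqrt M)⁻¹ * Real.exp (-(Real.pi * M / 4)) *
        (Real.sqrt M * (Real.exp (Real.pi * M / 4) * Real.exp (-(Real.pi * M * t ^ 2)) * 4))) := by
        gcongr
    _ = (Real.exp (-(Real.pi * M / 4)) * Real.exp (Real.pi * M / 4)) *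
        (4 / Real.sqrt M * Real.exp (-(Real.pi * M * t ^ 2))) := by
        field_simp
    _ = _ := by rw [hE, one_mul]

end
end

section
/- Fix 1/2 < δ < 1. There exists M₀ ∈ ℕ such that for every integer M ≥ M₀, with A = { l ∈ {0,…,M−1} : |l − M/2| ≤ M^δ/2 }, g the discrete Gaussian, and f = g·𝟙_A, one has Z_A(f) ≥ ‖f‖²·(1 − 170·e^{−(π/4)·M^{2δ−1}}), where ‖f‖² = Σ_{l∈ℤ}|f(l)|². -/
open scoped Classical

noncomputable section

/-- `Z_A(f) = min_{y ∈ [0,1/M]} Σ_{a ∈ A} |G_f(a/M + y)|²`. -/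
def ZA (M : ℕ) (A : Finset ℕ) (f : ℤ → ℂ) : ℝ :=
  sInf ((fun y => ∑ a ∈ A, ‖Gf M f ((a : ℝ) / (M : ℝ) + y)‖ ^ 2) ''
    Set.Icc 0 (1 / (M : ℝ)))

lemma aux_summable (a s : ℝ) (ha : 0 < a) :
    Summable (fun l : ℤ => Real.exp (-Real.pi * a * ((l : ℝ) - s) ^ 2)) := by
  have h := summable_pow_mul_jacobiTheta₂_term_bound (a * |s|) ha 0
  simp only [pow_zero, one_mul] at h
  refine Summable.of_nonneg_of_le (fun _ => (Real.exp_pos _).le) (fun l => ?_) h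
  apply Real.exp_le_exp.mpr
  have h1 : (l : ℝ) * s ≤ |(l : ℝ)| * |s| := by rw [← abs_mul]; exact le_abs_self _
  have hp := Real.pi_pos
  push_cast
  have h2 : a * (l : ℝ) ^ 2 - 2 * (a * |s|) * |(l : ℝ)| ≤ a * ((l : ℝ) - s) ^ 2 := by
    nlinarith [mul_le_mul_of_nonneg_left h1 ha.le, mul_nonneg ha.le (sq_nonneg s)]
  nlinarith [mul_le_mul_of_nonneg_left h2 hp.le]

def CC : ℝ := ∑' k : ℤ, Real.exp (-Real.pi * ((k : ℝ) ^ 2 - |(k : ℝ)|))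

lemma CC_summable : Summable (fun k : ℤ => Real.exp (-Real.pi * ((k : ℝ) ^ 2 - |(k : ℝ)|))) := by
  have h := summable_pow_mul_jacobiTheta₂_term_bound (1/2) one_pos 0
  simpa using h

lemma CC_nonneg : 0 ≤ CC := tsum_nonneg fun _ => (Real.exp_pos _).le

lemma aux_theta (a w : ℝ) (ha : 0 < a) (ha1 : a ≤ 1) (hw : |w| ≤ 1 / 2) :
    ∑' k : ℤ, Real.exp (-Real.pi / a * ((k : ℝ) + w) ^ 2) ≤
      CC * Real.exp (-Real.pi / a * w ^ 2) := by
  rw [CC, ← tsum_mul_right]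
  have hs : Summable (fun k : ℤ => Real.exp (-Real.pi / a * ((k : ℝ) + w) ^ 2)) := by
    refine (aux_summable (1 / a) (-w) (by positivity)).congr fun k => ?_
    congr 1; ring
  refine hs.tsum_le_tsum (fun k => ?_) (CC_summable.mul_right _)
  rw [← Real.exp_add]
  apply Real.exp_le_exp.mpr
  have hp := Real.pi_pos
  have h1 : -(|(k : ℝ)| * (1 / 2)) ≤ (k : ℝ) * w := by
    have : |(k : ℝ) * w| ≤ |(k : ℝ)| * (1 / 2) := by
      rw [abs_mul]; exact mul_le_mul_of_nonneg_left hw (abs_nonneg _)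
    linarith [neg_abs_le ((k : ℝ) * w)]
  have h2 : (0 : ℝ) ≤ (k : ℝ) ^ 2 - |(k : ℝ)| := by
    have : |k| ≤ k ^ 2 := by
      rw [← sq_abs]; rcases eq_or_lt_of_le (abs_nonneg k) with h | h <;> nlinarith
    have : ((|k| : ℤ) : ℝ) ≤ ((k ^ 2 : ℤ) : ℝ) := by exact_mod_cast this
    push_cast at this; linarith
  have h3 : Real.pi ≤ Real.pi / a := by
    rw [le_div_iff₀ ha]; nlinarith
  have h4 : (k : ℝ) ^ 2 - |(k : ℝ)| + w ^ 2 ≤ ((k : ℝ) + w) ^ 2 := by nlinarith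
  have h5 := mul_le_mul_of_nonneg_left h4 (by positivity : 0 ≤ Real.pi / a)
  have h6 := mul_le_mul_of_nonneg_right h3 h2
  have e : -Real.pi / a = -(Real.pi / a) := by ring
  rw [e]
  nlinarith

lemma aux_poisson (a s w : ℝ) (ha : 0 < a) :
    ‖∑' l : ℤ, (Real.exp (-Real.pi * a * ((l : ℝ) - s) ^ 2) : ℂ) * ec ((l : ℝ) * w)‖ ≤
      (Real.sqrt a)⁻¹ * ∑' k : ℤ, Real.exp (-Real.pi / a * ((k : ℝ) + w) ^ 2) := by
  have ha' : (a : ℂ) ≠ 0 := by exact_mod_cast ha.ne'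
  have key := Complex.tsum_exp_neg_quadratic (a := (a : ℂ)) (by simpa using ha)
    ((a * s : ℝ) - w * Complex.I)
  have e1 : ∀ l : ℤ, (Real.exp (-Real.pi * a * ((l : ℝ) - s) ^ 2) : ℂ) * ec ((l : ℝ) * w) =
      (Real.exp (-Real.pi * a * s ^ 2) : ℂ) *
      Complex.exp (-Real.pi * a * l ^ 2 + 2 * Real.pi * ((a * s : ℝ) - w * Complex.I) * l) := by
    intro l
    simp only [ec, Complex.ofReal_exp, ← Complex.exp_add]
    congr 1
    push_cast
    ring
  rw [tsum_congr e1, tsum_mul_left, key, norm_mul, norm_mul]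
  have e2 : ‖(1 / (a : ℂ) ^ (1 / 2 : ℂ))‖ = (Real.sqrt a)⁻¹ := by
    have : (a : ℂ) ^ (1 / 2 : ℂ) = ((a ^ (1 / 2 : ℝ) : ℝ) : ℂ) := by
      rw [Complex.ofReal_cpow ha.le]; norm_num
    rw [this, ← Real.sqrt_eq_rpow, norm_div, norm_one, Complex.norm_real, Real.norm_eq_abs,
      abs_of_nonneg (Real.sqrt_nonneg _), one_div]
  have e3 : ∀ k : ℤ, ‖Complex.exp (-Real.pi / a * (k + Complex.I * ((a * s : ℝ) - w * Complex.I)) ^ 2)‖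
      = Real.exp (Real.pi * a * s ^ 2) * Real.exp (-Real.pi / a * ((k : ℝ) + w) ^ 2) := by
    intro k
    rw [Complex.norm_exp, ← Real.exp_add]
    congr 1
    have : (-Real.pi / a * (k + Complex.I * ((a * s : ℝ) - w * Complex.I)) ^ 2 : ℂ) =
      ((Real.pi * a * s ^ 2 + -Real.pi / a * ((k : ℝ) + w) ^ 2 : ℝ) : ℂ) +
      ((-Real.pi / a * 2 * (k + w) * (a * s) : ℝ) : ℂ) * Complex.I := by
      push_cast
      field_simp
      ring_nf
      simp only [Complex.I_sq, show Complex.I ^ 4 = 1 from Complex.I_pow_four, show Complex.I ^ 3 = -Complex.I from Complex.I_pow_three]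
      ring
    rw [this, Complex.add_re, Complex.ofReal_re, Complex.re_ofReal_mul, Complex.I_re, mul_zero,
      add_zero]
  have hs : Summable (fun k : ℤ => Real.exp (-Real.pi / a * ((k : ℝ) + w) ^ 2)) := by
    refine (aux_summable (1 / a) (-w) (by positivity)).congr fun k => ?_
    congr 1; ring
  have h4 : ‖∑' k : ℤ, Complex.exp (-Real.pi / a * (k + Complex.I * ((a * s : ℝ) - w * Complex.I)) ^ 2)‖
      ≤ Real.exp (Real.pi * a * s ^ 2) * ∑' k : ℤ, Real.exp (-Real.pi / a * ((k : ℝ) + w) ^ 2) := by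
    rw [← tsum_mul_left]
    refine (norm_tsum_le_tsum_norm ?_).trans (le_of_eq (tsum_congr e3))
    exact (hs.mul_left _).congr fun k => (e3 k).symm
  rw [e2, Complex.norm_real, Real.norm_eq_abs, Real.abs_exp]
  calc _ ≤ Real.exp (-Real.pi * a * s ^ 2) * ((Real.sqrt a)⁻¹ * (Real.exp (Real.pi * a * s ^ 2) * ∑' k : ℤ, Real.exp (-Real.pi / a * ((k : ℝ) + w) ^ 2))) := by
        gcongr
    _ = (Real.exp (-Real.pi * a * s ^ 2) * Real.exp (Real.pi * a * s ^ 2)) * ((Real.sqrt a)⁻¹ * ∑' k : ℤ, Real.exp (-Real.pi / a * ((k : ℝ) + w) ^ 2)) := by ring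
    _ = _ := by
        rw [← Real.exp_add]
        have : -Real.pi * a * s ^ 2 + Real.pi * a * s ^ 2 = 0 := by ring
        rw [this, Real.exp_zero, one_mul]

lemma ec_add (x y : ℝ) : ec (x + y) = ec x * ec y := by
  simp only [ec, ← Complex.exp_add]; congr 1; push_cast; ring

lemma ec_norm (x : ℝ) : ‖ec x‖ = 1 := by
  rw [ec, show (-(2 * Real.pi * x) * Complex.I : ℂ) = ((-(2 * Real.pi * x) : ℝ) : ℂ) * Complex.I by
    push_cast; ring]
  exact Complex.norm_exp_ofReal_mul_I _

lemma ec_conj (x : ℝ) : (starRingEnd ℂ) (ec x) = ec (-x) := by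
  simp only [ec, ← Complex.exp_conj]; congr 1
  simp [Complex.conj_ofNat]

lemma ec_nat_mul (n : ℕ) (x : ℝ) : ec (n * x) = ec x ^ n := by
  simp only [ec, ← Complex.exp_nat_mul]; congr 1; push_cast; ring

lemma ec_orth (M : ℕ) (hM : 0 < M) (l m : ℕ) (hl : l < M) (hm : m < M) :
    ∑ a ∈ Finset.range M, ec (((l : ℝ) - m) * (a / M)) = if l = m then (M : ℂ) else 0 := by
  have hM' : (M : ℝ) ≠ 0 := by exact_mod_cast hM.ne'
  split_ifs with h
  · subst h; simp [ec]
  · set z := ec (((l : ℝ) - m) / M) with hz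
    have e : ∀ a ∈ Finset.range M, ec (((l : ℝ) - m) * (a / M)) = z ^ a := by
      intro a _
      rw [hz, ← ec_nat_mul]; congr 1; ring
    rw [Finset.sum_congr rfl e]
    have hzM : z ^ M = 1 := by
      rw [hz, ← ec_nat_mul, mul_div_cancel₀ _ hM', ec, Complex.exp_eq_one_iff]
      refine ⟨(m : ℤ) - l, ?_⟩
      push_cast; ring
    have hz1 : z ≠ 1 := by
      rw [hz, ec, Ne, Complex.exp_eq_one_iff]
      rintro ⟨n, hn⟩
      have hI := Complex.two_pi_I_ne_zero
      have h1 : (-(((l : ℝ) - m) / M : ℝ) : ℂ) = n := by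
        apply mul_right_cancel₀ hI
        rw [← hn]; push_cast; ring
      have h2 : -(((l : ℝ) - m) / M) = (n : ℝ) := by exact_mod_cast h1
      have h3 : (m : ℝ) - l = n * M := by
        rw [← h2]; field_simp; ring
      have h4 : (m : ℤ) - l = n * M := by exact_mod_cast h3
      have h5 : (M : ℤ) ∣ (m : ℤ) - l := ⟨n, by rw [h4]; ring⟩
      have h6 := Int.eq_zero_of_abs_lt_dvd h5 (by rw [abs_lt]; constructor <;> omega)
      omega
    rw [geom_sum_eq hz1, hzM]; simp

lemma parseval (M : ℕ) (hM : 0 < M) (c : ℕ → ℂ) :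
    ∑ a ∈ Finset.range M, ‖∑ l ∈ Finset.range M, c l * ec ((l : ℝ) * (a / M))‖ ^ 2 =
      M * ∑ l ∈ Finset.range M, ‖c l‖ ^ 2 := by
  have : ((∑ a ∈ Finset.range M, ‖∑ l ∈ Finset.range M, c l * ec ((l : ℝ) * (a / M))‖ ^ 2 : ℝ) : ℂ)
      = ((M * ∑ l ∈ Finset.range M, ‖c l‖ ^ 2 : ℝ) : ℂ) := by
    push_cast
    simp only [← Complex.mul_conj', map_sum, map_mul, ec_conj, Finset.sum_mul_sum]
    rw [Finset.sum_comm, Finset.mul_sum]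
    refine Finset.sum_congr rfl fun l hl => ?_
    rw [Finset.sum_comm]
    have e : ∀ m ∈ Finset.range M, ∑ a ∈ Finset.range M,
        c l * ec ((l : ℝ) * (a / M)) * ((starRingEnd ℂ) (c m) * ec (-((m : ℝ) * (a / M)))) =
        if l = m then (M : ℂ) * (c l * (starRingEnd ℂ) (c m)) else 0 := by
      intro m hm
      have e2 : ∀ a ∈ Finset.range M, c l * ec ((l : ℝ) * (a / M)) * ((starRingEnd ℂ) (c m) * ec (-((m : ℝ) * (a / M))))
          = (c l * (starRingEnd ℂ) (c m)) * ec (((l : ℝ) - m) * (a / M)) := by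
        intro a _
        rw [show ((l : ℝ) - m) * (a / M) = (l : ℝ) * (a / M) + -((m : ℝ) * (a / M)) by ring, ec_add]
        ring
      rw [Finset.sum_congr rfl e2, ← Finset.mul_sum,
        ec_orth M hM l m (Finset.mem_range.mp hl) (Finset.mem_range.mp hm)]
      split_ifs <;> ring
    rw [Finset.sum_congr rfl e, Finset.sum_ite_eq, if_pos hl]
  exact_mod_cast this

lemma aux_real (a s : ℝ) (ha : 0 < a) (ha1 : a ≤ 1) :
    ∑' l : ℤ, Real.exp (-Real.pi * a * ((l : ℝ) - s) ^ 2) ≤ (Real.sqrt a)⁻¹ * CC := by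
  have h := aux_poisson a s 0 ha
  have h2 := aux_theta a 0 ha ha1 (by norm_num)
  have e : ∀ l : ℤ, (Real.exp (-Real.pi * a * ((l : ℝ) - s) ^ 2) : ℂ) * ec ((l : ℝ) * 0) =
      ((Real.exp (-Real.pi * a * ((l : ℝ) - s) ^ 2) : ℝ) : ℂ) := by
    intro l; simp [ec]
  rw [tsum_congr e, ← Complex.ofReal_tsum, Complex.norm_real, Real.norm_eq_abs] at h
  have h3 : Real.exp (-Real.pi / a * 0 ^ 2) = 1 := by simp
  rw [h3, mul_one] at h2
  exact (le_abs_self _).trans (h.trans (mul_le_mul_of_nonneg_left h2 (by positivity)))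

lemma gauss_ec (M : ℕ) (x : ℝ) (l : ℤ) : gaussD M l * ec ((l : ℝ) * x) =
    ((Real.sqrt M)⁻¹ : ℝ) * ((Real.exp (-Real.pi * (1 / M) * ((l : ℝ) - (M : ℝ) / 2) ^ 2) : ℂ) *
      ec ((l : ℝ) * (x - 1 / 2))) := by
  rw [gaussD, show -Real.pi * (1 / M) * ((l : ℝ) - (M : ℝ) / 2) ^ 2 =
    -(Real.pi * ((l : ℝ) - (M : ℝ) / 2) ^ 2 / (M : ℝ)) by ring]
  have : ec ((l : ℝ) * (x - 1 / 2)) =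
      Complex.exp ((Real.pi * (l : ℝ) : ℝ) * Complex.I) * ec ((l : ℝ) * x) := by
    simp only [ec, ← Complex.exp_add]; congr 1; push_cast; ring
  rw [this, Complex.ofReal_mul]; ring

lemma gauss_norm (M : ℕ) (l : ℤ) : ‖gaussD M l‖ =
    (Real.sqrt M)⁻¹ * Real.exp (-Real.pi * (1 / M) * ((l : ℝ) - (M : ℝ) / 2) ^ 2) := by
  rw [gaussD, norm_mul, Complex.norm_exp_ofReal_mul_I, mul_one, Complex.norm_real,
    Real.norm_eq_abs, abs_of_nonneg (by positivity)]
  congr 2; ring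

lemma gauss_sum_bound (M : ℕ) (hM : 1 ≤ M) (x : ℝ) (hx : |x - 1 / 2| ≤ 1 / 2) :
    ‖∑' l : ℤ, gaussD M l * ec ((l : ℝ) * x)‖ ≤
      CC * Real.exp (-Real.pi * (M * (x - 1 / 2) ^ 2)) := by
  have hM' : (1 : ℝ) ≤ M := by exact_mod_cast hM
  have hM0 : (0 : ℝ) < M := by linarith
  have ha : (0 : ℝ) < 1 / M := by positivity
  have ha1 : (1 : ℝ) / M ≤ 1 := by rw [div_le_one hM0]; exact hM'
  rw [tsum_congr (gauss_ec M x), tsum_mul_left, norm_mul, Complex.norm_real, Real.norm_eq_abs,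
    abs_of_nonneg (by positivity)]
  have h1 := aux_poisson (1 / M) (M / 2) (x - 1 / 2) ha
  have h2 := aux_theta (1 / M) (x - 1 / 2) ha ha1 hx
  have h3 := h1.trans (mul_le_mul_of_nonneg_left h2 (by positivity))
  have h4 := mul_le_mul_of_nonneg_left h3 (by positivity : 0 ≤ (Real.sqrt M)⁻¹)
  refine h4.trans (le_of_eq ?_)
  have hs : Real.sqrt M ≠ 0 := by positivity
  rw [show -Real.pi / (1 / (M : ℝ)) * (x - 1 / 2) ^ 2 = -Real.pi * (M * (x - 1 / 2) ^ 2) by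
    field_simp]
  rw [Real.sqrt_div zero_le_one, Real.sqrt_one]
  field_simp

lemma tail_bound (M : ℕ) (hM : 1 ≤ M) (δ : ℝ) (hδ : δ < 1) :
    ∑' l : ℤ, ‖gaussD M l - restrictA (alphabetA M δ) (gaussD M) l‖ ≤
      3 * CC * Real.exp (-Real.pi * ((M : ℝ) ^ (2 * δ - 1) / 5)) := by
  have hM' : (1 : ℝ) ≤ M := by exact_mod_cast hM
  have hM0 : (0 : ℝ) < M := by linarith
  set t := (M : ℝ) ^ (2 * δ - 1) with ht
  have htM : t * M = ((M : ℝ) ^ δ) ^ 2 := by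
    rw [ht, ← Real.rpow_natCast, ← Real.rpow_mul hM0.le, ← Real.rpow_add_one hM0.ne']
    congr 1; push_cast; ring
  have hT : (M : ℝ) ^ δ ≤ M := by
    conv_rhs => rw [← Real.rpow_one (M : ℝ)]
    exact Real.rpow_le_rpow_of_exponent_le hM' hδ.le
  have hT0 : 0 < (M : ℝ) ^ δ := by positivity
  have ha : (0 : ℝ) < 1 / (5 * M) := by positivity
  have ha1 : (1 : ℝ) / (5 * M) ≤ 1 := by rw [div_le_one (by positivity)]; linarith
  have hpt : ∀ l : ℤ, ‖gaussD M l - restrictA (alphabetA M δ) (gaussD M) l‖ ≤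
      ((Real.sqrt M)⁻¹ * Real.exp (-Real.pi * (t / 5))) *
        Real.exp (-Real.pi * (1 / (5 * M)) * ((l : ℝ) - (M : ℝ) / 2) ^ 2) := by
    intro l
    unfold restrictA
    split_ifs with h
    · rw [sub_self, norm_zero]; positivity
    · rw [sub_zero, gauss_norm, mul_assoc (Real.sqrt M)⁻¹, ← Real.exp_add]
      refine mul_le_mul_of_nonneg_left (Real.exp_le_exp.mpr ?_) (by positivity)
      have hd : (M : ℝ) ^ δ / 2 ≤ |(l : ℝ) - (M : ℝ) / 2| := by
        by_contra hlt
        push Not at hlt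
        have h2 : |(l : ℝ) - (M : ℝ) / 2| < M / 2 := by linarith
        rw [abs_lt] at h2
        have h3 : (0 : ℝ) < (l : ℝ) := by linarith
        have h4 : (l : ℝ) < M := by linarith
        have h3' : 0 < l := by exact_mod_cast h3
        have h4' : l < M := by exact_mod_cast h4
        apply h
        refine ⟨l.toNat, ?_, by omega⟩
        rw [alphabetA, Finset.mem_filter, Finset.mem_range]
        refine ⟨by omega, ?_⟩
        have : ((l.toNat : ℕ) : ℝ) = (l : ℝ) := by
          exact_mod_cast (Int.toNat_of_nonneg h3'.le)
        rw [this]; exact hlt.le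
      have hd2 : t * M / 4 ≤ ((l : ℝ) - (M : ℝ) / 2) ^ 2 := by
        rw [htM, ← sq_abs ((l : ℝ) - (M : ℝ) / 2)]
        nlinarith
      set D := ((l : ℝ) - (M : ℝ) / 2) ^ 2
      have h5 : t / 4 ≤ D / M := by rw [le_div_iff₀ hM0]; linarith
      have h6 := mul_le_mul_of_nonneg_left h5 Real.pi_pos.le
      have e1 : -Real.pi * (1 / M) * D = -(Real.pi * (D / M)) := by ring
      have e2 : -Real.pi * (1 / (5 * M)) * D = -(Real.pi * (D / M)) / 5 := by
        field_simp
      rw [e1, e2]; linarith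
  have hsum := (aux_summable (1 / (5 * M)) (M / 2) ha)
  have hsum2 := hsum.mul_left ((Real.sqrt M)⁻¹ * Real.exp (-Real.pi * (t / 5)))
  have h1 := (Summable.of_nonneg_of_le (fun _ => norm_nonneg _) hpt hsum2).tsum_le_tsum hpt hsum2
  rw [tsum_mul_left] at h1
  refine h1.trans ((mul_le_mul_of_nonneg_left (aux_real _ _ ha ha1) (by positivity)).trans ?_)
  have hs : 0 < Real.sqrt M := by positivity
  have h5 : (Real.sqrt M)⁻¹ * (Real.sqrt (1 / (5 * M)))⁻¹ ≤ 3 := by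
    rw [Real.sqrt_div zero_le_one, Real.sqrt_one, Real.sqrt_mul (by norm_num)]
    have : Real.sqrt 5 ≤ 3 := by rw [Real.sqrt_le_left (by norm_num)]; norm_num
    field_simp
    exact this
  have h6 := mul_le_mul_of_nonneg_right h5
    (mul_nonneg CC_nonneg (Real.exp_pos (-Real.pi * (t / 5))).le)
  calc _ = (Real.sqrt M)⁻¹ * (Real.sqrt (1 / (5 * M)))⁻¹ * (CC * Real.exp (-Real.pi * (t / 5))) := by
        ring
    _ ≤ _ := h6.trans (le_of_eq (by ring))

lemma gaussD_summable (M : ℕ) (hM : 1 ≤ M) : Summable (fun l => ‖gaussD M l‖) := by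
  have hM' : (1 : ℝ) ≤ M := by exact_mod_cast hM
  have ha : (0 : ℝ) < 1 / M := by positivity
  exact ((aux_summable (1 / M) (M / 2) ha).mul_left ((Real.sqrt M)⁻¹)).congr
    fun l => (gauss_norm M l).symm

lemma restrict_norm_le (A : Finset ℕ) (f : ℤ → ℂ) (l : ℤ) : ‖restrictA A f l‖ ≤ ‖f l‖ := by
  unfold restrictA; split_ifs <;> simp

lemma f_bound (M : ℕ) (hM : 1 ≤ M) (δ : ℝ) (hδ : δ < 1) (x : ℝ) (hx : |x - 1 / 2| ≤ 1 / 2)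
    (hx2 : (M : ℝ) ^ (2 * δ - 1) / 5 ≤ M * (x - 1 / 2) ^ 2) :
    ‖∑' l : ℤ, restrictA (alphabetA M δ) (gaussD M) l * ec ((l : ℝ) * x)‖ ≤
      4 * CC * Real.exp (-Real.pi * ((M : ℝ) ^ (2 * δ - 1) / 5)) := by
  set f := restrictA (alphabetA M δ) (gaussD M) with hf
  have hg := gaussD_summable M hM
  have hfs : Summable (fun l => ‖f l‖) :=
    Summable.of_nonneg_of_le (fun _ => norm_nonneg _) (fun l => restrict_norm_le _ _ l) hg
  have s1 : Summable (fun l : ℤ => gaussD M l * ec ((l : ℝ) * x)) := by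
    apply Summable.of_norm; simpa [ec_norm] using hg
  have hd : Summable (fun l => ‖gaussD M l - f l‖) :=
    (hg.of_norm.sub hfs.of_norm).norm
  have s2 : Summable (fun l : ℤ => (gaussD M l - f l) * ec ((l : ℝ) * x)) := by
    apply Summable.of_norm; simpa [ec_norm] using hd
  have e : ∑' l : ℤ, f l * ec ((l : ℝ) * x) = ∑' l : ℤ, gaussD M l * ec ((l : ℝ) * x) -
      ∑' l : ℤ, (gaussD M l - f l) * ec ((l : ℝ) * x) := by
    rw [← s1.tsum_sub s2]; refine tsum_congr fun l => ?_; ring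
  rw [e]
  have h1 := gauss_sum_bound M hM x hx
  have h2 : ‖∑' l : ℤ, (gaussD M l - f l) * ec ((l : ℝ) * x)‖ ≤ ∑' l : ℤ, ‖gaussD M l - f l‖ := by
    refine (norm_tsum_le_tsum_norm s2.norm).trans (le_of_eq (tsum_congr fun l => ?_))
    rw [norm_mul, ec_norm, mul_one]
  have h3 := tail_bound M hM δ hδ
  have h4 : Real.exp (-Real.pi * (M * (x - 1 / 2) ^ 2)) ≤
      Real.exp (-Real.pi * ((M : ℝ) ^ (2 * δ - 1) / 5)) := by
    apply Real.exp_le_exp.mpr; nlinarith [Real.pi_pos]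
  have h5 := mul_le_mul_of_nonneg_left h4 CC_nonneg
  refine (norm_sub_le _ _).trans ?_
  linarith

lemma restrict_tsum {E : Type*} [NormedAddCommGroup E] (M : ℕ) (F : ℤ → E)
    (hF : ∀ l : ℤ, (¬ ∃ a ∈ Finset.range M, l = (a : ℤ)) → F l = 0) :
    ∑' l : ℤ, F l = ∑ l ∈ Finset.range M, F (l : ℤ) := by
  rw [tsum_eq_sum (s := (Finset.range M).map Nat.castEmbedding), Finset.sum_map]
  · rfl
  · intro l hl
    apply hF
    rintro ⟨a, ha, rfl⟩
    exact hl (Finset.mem_map.mpr ⟨a, ha, rfl⟩)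

lemma restrict_zero (M : ℕ) (δ : ℝ) (f : ℤ → ℂ) (l : ℤ)
    (h : ¬ ∃ a ∈ Finset.range M, l = (a : ℤ)) : restrictA (alphabetA M δ) f l = 0 := by
  unfold restrictA
  rw [if_neg]
  rintro ⟨a, ha, e⟩
  exact h ⟨a, (Finset.mem_filter.mp ha).1, e⟩

lemma G_parseval (M : ℕ) (hM : 1 ≤ M) (δ : ℝ) (g : ℤ → ℂ) (y : ℝ) :
    ∑ a ∈ Finset.range M, ‖Gf M (restrictA (alphabetA M δ) g) ((a : ℝ) / M + y)‖ ^ 2 =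
      ∑' l : ℤ, ‖restrictA (alphabetA M δ) g l‖ ^ 2 := by
  have hM' : (1 : ℝ) ≤ M := by exact_mod_cast hM
  have hM0 : (0 : ℝ) < M := by linarith
  set f := restrictA (alphabetA M δ) g with hf
  have hz : ∀ l : ℤ, (¬ ∃ a ∈ Finset.range M, l = (a : ℤ)) → f l = 0 :=
    fun l h => restrict_zero M δ g l h
  rw [restrict_tsum M (fun l => ‖f l‖ ^ 2) (fun l h => by simp [hz l h])]
  have hp := parseval M hM (fun l => f (l : ℤ) * ec ((l : ℝ) * y))
  simp only [norm_mul, ec_norm, mul_one] at hp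
  have e : ∀ a ∈ Finset.range M, ‖Gf M f ((a : ℝ) / M + y)‖ ^ 2 =
      (M : ℝ)⁻¹ * ‖∑ l ∈ Finset.range M, f (l : ℤ) * ec ((l : ℝ) * y) * ec ((l : ℝ) * (a / M))‖ ^ 2 := by
    intro a _
    rw [Gf, restrict_tsum M _ (fun l h => by rw [hz l h, zero_mul]), norm_mul, mul_pow,
      Complex.norm_real, Real.norm_eq_abs, sq_abs, inv_pow, Real.sq_sqrt hM0.le]
    congr 3
    refine Finset.sum_congr rfl fun l _ => ?_
    rw [Int.cast_natCast, mul_add, ec_add]; ring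
  rw [Finset.sum_congr rfl e, ← Finset.mul_sum, hp, inv_mul_cancel_left₀ hM0.ne']

lemma norm_lower (M : ℕ) (hM : 1 ≤ M) (δ : ℝ) (hδ : 0 < δ) :
    Real.exp (-2 * Real.pi) / M ≤ ∑' l : ℤ, ‖restrictA (alphabetA M δ) (gaussD M) l‖ ^ 2 := by
  have hM' : (1 : ℝ) ≤ M := by exact_mod_cast hM
  have hM0 : (0 : ℝ) < M := by linarith
  rw [restrict_tsum M (fun l => ‖restrictA (alphabetA M δ) (gaussD M) l‖ ^ 2)
    (fun l h => by simp [restrict_zero M δ _ l h])]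
  have hk : M / 2 ∈ Finset.range M := by rw [Finset.mem_range]; omega
  have h1 : ((M / 2 : ℕ) : ℝ) ≤ M / 2 := Nat.cast_div_le
  have h2 : (M : ℝ) / 2 - 1 / 2 ≤ ((M / 2 : ℕ) : ℝ) := by
    have : M ≤ 2 * (M / 2) + 1 := by omega
    have : (M : ℝ) ≤ 2 * ((M / 2 : ℕ) : ℝ) + 1 := by exact_mod_cast this
    linarith
  have hT : 1 ≤ (M : ℝ) ^ δ := Real.one_le_rpow hM' hδ.le
  have hA : M / 2 ∈ alphabetA M δ := by
    rw [alphabetA, Finset.mem_filter]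
    refine ⟨hk, ?_⟩
    rw [abs_le]; constructor <;> linarith
  refine le_trans ?_ (Finset.single_le_sum (fun i _ => by positivity) hk)
  rw [restrictA, if_pos ⟨_, hA, rfl⟩, gauss_norm, mul_pow, inv_pow, Real.sq_sqrt hM0.le,
    ← Real.exp_nat_mul, Int.cast_natCast, div_eq_inv_mul]
  refine mul_le_mul_of_nonneg_left (Real.exp_le_exp.mpr ?_) (by positivity)
  have h3 : (((M / 2 : ℕ) : ℝ) - M / 2) ^ 2 ≤ 1 := by nlinarith
  have h4 : (1 / (M : ℝ)) * (((M / 2 : ℕ) : ℝ) - M / 2) ^ 2 ≤ 1 := by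
    have : 1 / (M : ℝ) ≤ 1 := by rw [div_le_one hM0]; exact hM'
    calc _ ≤ (1 : ℝ) * 1 := by gcongr
      _ = 1 := one_mul 1
  push_cast at h4 ⊢
  nlinarith [Real.pi_pos]

lemma eventually_ok (δ : ℝ) (hδ1 : 1 / 2 < δ) : ∃ M₀ : ℕ, ∀ M : ℕ, M₀ ≤ M → 1 ≤ M ∧
    20 ≤ (M : ℝ) ^ δ ∧
    16 * CC ^ 2 * Real.exp (-Real.pi * ((M : ℝ) ^ (2 * δ - 1) / 5)) ^ 2 ≤
      Real.exp (-2 * Real.pi) / M *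
        (170 * Real.exp (-(Real.pi / 4) * (M : ℝ) ^ (2 * δ - 1))) := by
  have c1 : Filter.Tendsto (fun M : ℕ => (M : ℝ) ^ δ) Filter.atTop Filter.atTop :=
    (tendsto_rpow_atTop (by linarith)).comp tendsto_natCast_atTop_atTop
  have c2 : Filter.Tendsto (fun M : ℕ => (M : ℝ) ^ (2 * δ - 1)) Filter.atTop Filter.atTop :=
    (tendsto_rpow_atTop (by linarith)).comp tendsto_natCast_atTop_atTop
  have c3 := (tendsto_rpow_mul_exp_neg_mul_atTop_nhds_zero (1 / (2 * δ - 1)) (3 * Real.pi / 20)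
    (by positivity)).comp c2
  have c4 := c3.const_mul (16 * CC ^ 2)
  rw [mul_zero] at c4
  have hpos : (0 : ℝ) < Real.exp (-2 * Real.pi) * 170 := by positivity
  have ev := ((Filter.eventually_ge_atTop 1).and (c1.eventually_ge_atTop 20)).and
    (c4.eventually_le_const hpos)
  obtain ⟨M₀, h⟩ := Filter.eventually_atTop.mp ev
  refine ⟨M₀, fun M hMM => ?_⟩
  obtain ⟨⟨h1, h2⟩, h3⟩ := h M hMM
  refine ⟨h1, h2, ?_⟩
  have hM0 : (0 : ℝ) < M := by exact_mod_cast h1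
  simp only [Function.comp] at h3
  rw [← Real.rpow_mul hM0.le, mul_one_div_cancel (by linarith), Real.rpow_one] at h3
  set t := (M : ℝ) ^ (2 * δ - 1)
  have e1 : Real.exp (-Real.pi * (t / 5)) ^ 2 =
      Real.exp (-(3 * Real.pi / 20) * t) * Real.exp (-(Real.pi / 4) * t) := by
    rw [← Real.exp_nat_mul, ← Real.exp_add]; congr 1; push_cast; ring
  rw [e1, div_mul_eq_mul_div, le_div_iff₀ hM0]
  have h4 := mul_le_mul_of_nonneg_right h3 (Real.exp_pos (-(Real.pi / 4) * t)).le
  linarith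

/-- `Z_A(f) ≥ ‖f‖² (1 - 170 e^{-(π/4) M^{2δ-1}})` for `f = g·𝟙_A`. -/
theorem stmt11 (δ : ℝ) (hδ1 : 1 / 2 < δ) (hδ2 : δ < 1) :
    ∃ M₀ : ℕ, ∀ M : ℕ, M₀ ≤ M →
      (∑' l : ℤ, ‖restrictA (alphabetA M δ) (gaussD M) l‖ ^ 2) *
          (1 - 170 * Real.exp (-(Real.pi / 4) * (M : ℝ) ^ (2 * δ - 1))) ≤
        ZA M (alphabetA M δ) (restrictA (alphabetA M δ) (gaussD M)) := by
  obtain ⟨M₀, h⟩ := eventually_ok δ hδ1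
  refine ⟨M₀, fun M hMM => ?_⟩
  obtain ⟨hM, hT, hfin⟩ := h M hMM
  have hM' : (1 : ℝ) ≤ M := by exact_mod_cast hM
  have hM0 : (0 : ℝ) < M := by linarith
  rw [ZA]
  apply le_csInf
  · exact (Set.nonempty_Icc.mpr (by positivity)).image _
  rintro _ ⟨y, ⟨hy0, hy1⟩, rfl⟩
  have hpar := G_parseval M hM δ (gaussD M) y
  have hlow := norm_lower M hM δ (by linarith)
  have hsub : alphabetA M δ ⊆ Finset.range M := Finset.filter_subset _ _
  rw [← Finset.sum_sdiff hsub] at hpar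
  have htM : (M : ℝ) ^ (2 * δ - 1) * M = ((M : ℝ) ^ δ) ^ 2 := by
    rw [← Real.rpow_natCast, ← Real.rpow_mul hM0.le, ← Real.rpow_add_one hM0.ne']
    congr 1; push_cast; ring
  have hb : ∑ a ∈ Finset.range M \ alphabetA M δ,
      ‖Gf M (restrictA (alphabetA M δ) (gaussD M)) ((a : ℝ) / M + y)‖ ^ 2 ≤
      16 * CC ^ 2 * Real.exp (-Real.pi * ((M : ℝ) ^ (2 * δ - 1) / 5)) ^ 2 := by
    have hpt : ∀ a ∈ Finset.range M \ alphabetA M δ,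
        ‖Gf M (restrictA (alphabetA M δ) (gaussD M)) ((a : ℝ) / M + y)‖ ^ 2 ≤
        (M : ℝ)⁻¹ * (16 * CC ^ 2 * Real.exp (-Real.pi * ((M : ℝ) ^ (2 * δ - 1) / 5)) ^ 2) := by
      intro a ha
      rw [Finset.mem_sdiff, alphabetA, Finset.mem_filter, not_and] at ha
      obtain ⟨ha1, ha2⟩ := ha
      have ha3 := ha2 ha1
      push Not at ha3
      have ha4 : a + 1 ≤ M := Finset.mem_range.mp ha1
      have ha5 : (a : ℝ) + 1 ≤ M := by exact_mod_cast ha4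
      set θ := y * M with hθ
      have hθ0 : 0 ≤ θ := by positivity
      have hθ1 : θ ≤ 1 := by rw [hθ, ← le_div_iff₀ hM0]; exact hy1
      set x := (a : ℝ) / M + y with hx
      have hxM : (x - 1 / 2) * M = ((a : ℝ) - M / 2) + θ := by
        rw [hx, hθ]; field_simp; ring
      have hx0 : 0 ≤ x := by positivity
      have hx1 : x ≤ 1 := by
        have : x * M ≤ 1 * M := by linarith
        exact le_of_mul_le_mul_right this hM0
      have hxa : |x - 1 / 2| ≤ 1 / 2 := by rw [abs_le]; constructor <;> linarith
      have hbig : (9 / 10 * ((M : ℝ) ^ δ / 2)) ≤ |(x - 1 / 2) * M| := by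
        rw [hxM]
        rcases lt_abs.mp ha3 with h | h
        · exact le_trans (by linarith) (le_abs_self _)
        · exact le_trans (by linarith) (neg_le_abs _)
      have hx2 : (M : ℝ) ^ (2 * δ - 1) / 5 ≤ M * (x - 1 / 2) ^ 2 := by
        have h1 : (9 / 10 * ((M : ℝ) ^ δ / 2)) ^ 2 ≤ ((x - 1 / 2) * M) ^ 2 := by
          rw [← sq_abs ((x - 1 / 2) * M)]
          exact pow_le_pow_left₀ (by positivity) hbig 2
        have h2 : (M : ℝ) ^ (2 * δ - 1) / 5 * M ≤ M * (x - 1 / 2) ^ 2 * M := by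
          nlinarith [sq_nonneg ((M : ℝ) ^ δ)]
        exact le_of_mul_le_mul_right h2 hM0
      have hfb := f_bound M hM δ hδ2 x hxa hx2
      rw [Gf, norm_mul, mul_pow, Complex.norm_real, Real.norm_eq_abs, sq_abs, inv_pow,
        Real.sq_sqrt hM0.le]
      refine mul_le_mul_of_nonneg_left ?_ (by positivity)
      refine (pow_le_pow_left₀ (norm_nonneg _) hfb 2).trans (le_of_eq (by ring))
    refine (Finset.sum_le_card_nsmul _ _ _ hpt).trans ?_
    have hc : ((Finset.range M \ alphabetA M δ).card : ℝ) ≤ M := by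
      have := Finset.card_le_card (Finset.sdiff_subset (s := Finset.range M) (t := alphabetA M δ))
      rw [Finset.card_range] at this
      exact_mod_cast this
    rw [nsmul_eq_mul]
    refine (mul_le_mul_of_nonneg_right hc (by positivity)).trans (le_of_eq ?_)
    rw [mul_inv_cancel_left₀ hM0.ne']
  have h1 := mul_le_mul_of_nonneg_right hlow
    (by positivity : 0 ≤ 170 * Real.exp (-(Real.pi / 4) * (M : ℝ) ^ (2 * δ - 1)))
  show _ ≤ ∑ a ∈ alphabetA M δ,
      ‖Gf M (restrictA (alphabetA M δ) (gaussD M)) ((a : ℝ) / M + y)‖ ^ 2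
  rw [mul_sub, mul_one]
  linarith

end
end

section
/- There exists a Schwartz function ψ : ℝ → ℂ such that the Fourier transform ψ̂(ξ) = ∫_ℝ e^{−i·x·ξ}·ψ(x) dx has support contained in the open interval (−π, π), ψ(x) ≠ 0 for every x ∈ ℝ, and |ψ(x)| ≥ 1 for all x ∈ [−1, 1]. -/
open MeasureTheory

lemma aux_countable (G : ℂ → ℂ) (hG : AnalyticOnNhd ℂ G Set.univ) (h0 : G 0 ≠ 0) :
    {z | G z = 0}.Countable := by
  have h := hG.preimage_zero_mem_codiscrete h0
  rw [mem_codiscrete'] at h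
  have e : (G ⁻¹' {0}ᶜ)ᶜ = {z | G z = 0} := by ext; simp
  rw [e] at h
  exact (HereditarilyLindelof_LindelofSets _).countable_of_isDiscrete h.2

open FourierTransform ProbabilityTheory in
lemma aux_main (φ : ContDiffBump (0 : ℝ)) (hφ : φ.rOut ≤ 1/2) :
    ∃ ψ : SchwartzMap ℝ ℂ, (∀ ξ, 𝓕 ψ ξ ≠ 0 → |ξ| < 1/2) ∧ ∀ x, ψ x ≠ 0 := by
  let μ : Measure ℝ := volume.withDensity (fun t => ENNReal.ofReal (φ t))
  have hm : Measurable (fun t => ENNReal.ofReal (φ t)) := by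
    have := φ.continuous.measurable
    fun_prop
  have hint : ∀ g : ℝ → ℂ, ∫ t, g t ∂μ = ∫ t, (φ t : ℂ) * g t := by
    intro g
    rw [integral_withDensity_eq_integral_toReal_smul hm (by simp)]
    simp [ENNReal.toReal_ofReal φ.nonneg]
  have hset : integrableExpSet id μ = Set.univ := by
    ext s
    simp only [integrableExpSet, Set.mem_setOf_eq, Set.mem_univ, iff_true]
    rw [integrable_withDensity_iff_integrable_smul' hm (by simp)]
    simp only [ENNReal.toReal_ofReal φ.nonneg, smul_eq_mul]
    refine Continuous.integrable_of_hasCompactSupport ?_ ?_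
    · have := φ.continuous
      fun_prop
    · exact φ.hasCompactSupport.mul_right
  have hG : AnalyticOnNhd ℂ (complexMGF id μ) Set.univ := by
    have := analyticOnNhd_complexMGF (X := id) (μ := μ)
    simpa [hset] using this
  have h0 : complexMGF id μ 0 ≠ 0 := by
    rw [complexMGF, hint]
    simp only [zero_mul, Complex.exp_zero, mul_one]
    rw [integral_complex_ofReal]
    exact_mod_cast (φ.integral_pos (μ := volume)).ne'
  have hc := (aux_countable _ hG h0).image Complex.re
  obtain ⟨s, hs⟩ : ∃ s : ℝ, s ∉ Complex.re '' {z | complexMGF id μ z = 0} := by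
    by_contra! h
    exact Set.not_countable_univ (hc.mono (fun x _ => h x))
  let f : ℝ → ℂ := fun t => ((φ t : ℝ) : ℂ) * ((Real.exp (s * t) : ℝ) : ℂ)
  have hf1 : HasCompactSupport f := by
    apply HasCompactSupport.mul_right
    exact φ.hasCompactSupport.comp_left (g := fun r : ℝ => (r : ℂ)) (by simp)
  have hf2 : ContDiff ℝ (⊤ : ℕ∞) f := by
    have h1 : ContDiff ℝ (⊤ : ℕ∞) (fun t => φ t) := φ.contDiff
    have h2 : ContDiff ℝ (⊤ : ℕ∞) (fun t : ℝ => Real.exp (s * t)) := by fun_prop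
    exact (Complex.ofRealCLM.contDiff.comp h1).mul (Complex.ofRealCLM.contDiff.comp h2)
  let F : SchwartzMap ℝ ℂ := hf1.toSchwartzMap hf2
  have hF : ∀ t, F t = f t := fun t => rfl
  refine ⟨𝓕⁻ F, ?_, ?_⟩
  · intro ξ h
    rw [fourier_fourierInv_eq, hF] at h
    have : ξ ∈ Function.support φ := by
      intro h'
      exact h (by simp [f, h'])
    rw [φ.support_eq] at this
    simp at this
    linarith
  · intro x hx
    apply hs
    refine ⟨s + 2 * Real.pi * x * Complex.I, ?_, by simp⟩
    rw [Set.mem_setOf_eq, complexMGF, hint, ← hx, SchwartzMap.fourierInv_coe, Real.fourierInv_eq']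
    congr 1
    ext t
    rw [hF]
    simp only [f, smul_eq_mul, id]
    rw [mul_left_comm]
    push_cast
    rw [← Complex.exp_add]
    congr 2
    simp
    ring

open FourierTransform in
/-- There is a Schwartz function `ψ` whose Fourier transform
`ψ̂(ξ) = ∫ e^{-ixξ} ψ(x) dx` is supported in `(-π, π)`, with `ψ` nowhere vanishing and
`|ψ| ≥ 1` on `[-1, 1]`. -/
theorem stmt13 :
    ∃ ψ : SchwartzMap ℝ ℂ,
      (Function.support (fun ξ : ℝ =>
        ∫ x : ℝ, Complex.exp (-((x * ξ : ℝ) : ℂ) * Complex.I) * ψ x) ⊆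
          Set.Ioo (-Real.pi) Real.pi) ∧
      (∀ x : ℝ, ψ x ≠ 0) ∧ ∀ x ∈ Set.Icc (-1 : ℝ) 1, 1 ≤ ‖ψ x‖ := by
  obtain ⟨ψ, h1, h2⟩ := aux_main ⟨1/4, 1/2, by norm_num, by norm_num⟩ le_rfl
  obtain ⟨y, -, hy⟩ := (isCompact_Icc (a := (-1 : ℝ)) (b := 1)).exists_isMinOn
    ⟨0, by simp⟩ (f := fun x => ‖ψ x‖) (ψ.continuous.norm.continuousOn)
  have hm : 0 < ‖ψ y‖ := norm_pos_iff.2 (h2 y)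
  have hm' : ((‖ψ y‖⁻¹ : ℝ) : ℂ) ≠ 0 := by
    exact_mod_cast (inv_pos.2 hm).ne'
  refine ⟨((‖ψ y‖⁻¹ : ℝ) : ℂ) • ψ, ?_, ?_, ?_⟩
  · intro ξ hξ
    have hpi := Real.pi_pos
    have key : |ξ / (2 * Real.pi)| < 1/2 := by
      apply h1
      intro h
      apply hξ
      rw [SchwartzMap.fourier_coe, Real.fourier_real_eq_integral_exp_smul] at h
      have : ∀ x : ℝ, Complex.exp (-((x * ξ : ℝ) : ℂ) * Complex.I) *
          (((‖ψ y‖⁻¹ : ℝ) : ℂ) • ψ) x = ((‖ψ y‖⁻¹ : ℝ) : ℂ) *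
          (Complex.exp (((-2 * Real.pi * x * (ξ / (2 * Real.pi)) : ℝ) : ℂ) * Complex.I) • ψ x) := by
        intro x
        have e : -2 * Real.pi * x * (ξ / (2 * Real.pi)) = -(x * ξ) := by
          field_simp
        rw [e, SchwartzMap.smul_apply, smul_eq_mul, smul_eq_mul, Complex.ofReal_neg]
        ring
      simp_rw [this]
      rw [integral_const_mul, h, mul_zero]
    rw [abs_lt, lt_div_iff₀ (by positivity), div_lt_iff₀ (by positivity)] at key
    constructor <;> linarith [key.1, key.2]
  · intro x
    rw [SchwartzMap.smul_apply]
    exact smul_ne_zero hm' (h2 x)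
  · intro x hx
    rw [SchwartzMap.smul_apply, norm_smul, Complex.norm_real, norm_inv, norm_norm,
      ← inv_mul_cancel₀ hm.ne']
    exact mul_le_mul_of_nonneg_left (hy hx) (by positivity)
end
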